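/- Let 0 ≤ m ≤ n be integers, a > 0, and Q ∈ Π_n^m with ‖Q‖ = 1. Then ‖Q − Σ_{k=−n}^n Σ_{i : x_{|k|,i} > 1−a} ⟨Q, ψ_{k,i}⟩ ψ_{k,i}‖² ≤ (1 − ε(Q))/a. -/

import Mathlib

open MeasureTheory Finset

noncomputable section

namespace SFT

/-- The recurrence coefficients `b_l^{(α)}` of the orthonormal ultraspherical polynomials. -/
def b (α : ℝ) : ℕ → ℝ
  | 0 => Real.sqrt (Real.sqrt Real.pi * Real.Gamma (α + 1) / (2 * Real.Gamma (α + 3 / 2)))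
  | l + 1 => Real.sqrt ((((l : ℝ) + 1) * (((l : ℝ) + 1) + 2 * α)) /
      ((2 * ((l : ℝ) + 1) + 2 * α + 1) * (2 * ((l : ℝ) + 1) + 2 * α - 1)))

/-- The associated ultraspherical polynomials: `pA α m l x = p_l^{(α)}(x, m)`.
For `m = 0` these are the orthonormal ultraspherical polynomials `p_l^{(α)}(x)`. -/
def pA (α : ℝ) (m : ℕ) : ℕ → ℝ → ℝ
  | 0, _ => 1 / b α m
  | 1, x => x * (1 / b α m) / b α (m + 1)
  | l + 2, x => (x * pA α m (l + 1) x - b α (m + l + 1) * pA α m l x) / b α (m + l + 2)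

/-- The orthonormal ultraspherical polynomials `p_l^{(α)}(x)`. -/
def p (α : ℝ) (l : ℕ) (x : ℝ) : ℝ := pA α 0 l x

/-- Ultraspherical polynomials with integer index; in particular `p_{-1}^{(α)} = 0`. -/
def pZ (α : ℝ) (l : ℤ) (x : ℝ) : ℝ := if 0 ≤ l then p α l.toNat x else 0

/-- `JE α M i j` is the `(i,j)` entry (`0`-based) of the truncated Jacobi matrix
`J(α)_L^M` (of any size `L − M + 1`). -/
def JE (α : ℝ) (M : ℕ) (i j : ℕ) : ℝ :=
  if i + 1 = j then b α (M + i + 1) else if j + 1 = i then b α (M + j + 1) else 0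

/-- The truncated Jacobi matrix `J(α)_{M+l}^M`, of size `(l+1) × (l+1)`.
In particular `Jt α 0 l` is the Jacobi matrix `J(α)_l`. -/
def Jt (α : ℝ) (M l : ℕ) : Matrix (Fin (l + 1)) (Fin (l + 1)) ℝ :=
  fun i j => JE α M i.1 j.1

/-- The spherical harmonics `Y_l^k(θ, φ)`. -/
def Y (l : ℕ) (k : ℤ) (θ φ : ℝ) : ℂ :=
  ((Real.sin θ ^ k.natAbs : ℝ) : ℂ) * ((p (k.natAbs : ℝ) (l - k.natAbs) (Real.cos θ) : ℝ) : ℂ) *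
    Complex.exp (Complex.I * (k : ℂ) * (φ : ℂ))

/-- Parameter region `[0, π] × [0, 2π]` of spherical coordinates. -/
def region : Set (ℝ × ℝ) := Set.Icc (0 : ℝ) Real.pi ×ˢ Set.Icc (0 : ℝ) (2 * Real.pi)

/-- The inner product of `L²(S²)`. -/
def inner2 (f g : ℝ → ℝ → ℂ) : ℂ :=
  (1 / (4 * Real.pi)) *
    ∫ q in region, f q.1 q.2 * (starRingEnd ℂ) (g q.1 q.2) * ((Real.sin q.1 : ℝ) : ℂ)

/-- The norm of `L²(S²)`. -/
def norm2 (f : ℝ → ℝ → ℂ) : ℝ := Real.sqrt (inner2 f f).re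

/-- Membership in `L²(S²)`. -/
def MemL2 (f : ℝ → ℝ → ℂ) : Prop :=
  Measurable (fun q : ℝ × ℝ => f q.1 q.2) ∧
    IntegrableOn (fun q : ℝ × ℝ => ‖f q.1 q.2‖ ^ 2 * Real.sin q.1) region

/-- The multiplication operator `M`. -/
def Mop (f : ℝ → ℝ → ℂ) : ℝ → ℝ → ℂ := fun θ φ => ((Real.cos θ : ℝ) : ℂ) * f θ φ

/-- The power `M^j` of the multiplication operator. -/
def Mpow (j : ℕ) (f : ℝ → ℝ → ℂ) : ℝ → ℝ → ℂ := fun θ φ => ((Real.cos θ : ℝ) : ℂ) ^ j * f θ φ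

/-- The mean value `ε(f)`. -/
def eps (f : ℝ → ℝ → ℂ) : ℝ :=
  (1 / (4 * Real.pi)) * ∫ q in region, Real.cos q.1 * ‖f q.1 q.2‖ ^ 2 * Real.sin q.1

/-- The projection `P_n^m` onto `Π_n^m`. -/
def Pr (n m : ℕ) (f : ℝ → ℝ → ℂ) : ℝ → ℝ → ℂ :=
  fun θ φ => ∑ l ∈ Finset.Icc m n, ∑ k ∈ Finset.Icc (-(l : ℤ)) (l : ℤ),
    inner2 f (Y l k) * Y l k θ φ

/-- The space–frequency operator `P_n^m M P_n^m`. -/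
def SFop (n m : ℕ) (f : ℝ → ℝ → ℂ) : ℝ → ℝ → ℂ := Pr n m (Mop (Pr n m f))

/-- The space `Π_n^m`, spanned by the spherical harmonics `Y_l^k`, `m ≤ l ≤ n`, `|k| ≤ l`. -/
def Pi_nm (n m : ℕ) : Submodule ℂ (ℝ → ℝ → ℂ) :=
  Submodule.span ℂ {g | ∃ l : ℕ, ∃ k : ℤ, m ≤ l ∧ l ≤ n ∧ k.natAbs ≤ l ∧ g = Y l k}

/-- `N_k = n − max(|k|, m) + 1`. -/
def Nk (n m k : ℕ) : ℕ := n - max k m + 1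

/-- The normalizing constant `κ_{k,i}`, given the corresponding root value `xr`. -/
def kap (n m k : ℕ) (xr : ℝ) : ℝ :=
  (Real.sqrt (∑ l ∈ Finset.Icc (max k m) n, (pA (k : ℝ) (m - k) (l - max k m) xr) ^ 2))⁻¹

/-- The eigenfunction `ψ_{k,i}`, given the corresponding root value `xr`. -/
def psiFun (n m : ℕ) (k : ℤ) (xr : ℝ) : ℝ → ℝ → ℂ :=
  fun θ φ => ((kap n m k.natAbs xr : ℝ) : ℂ) *
    ∑ l ∈ Finset.Icc (max k.natAbs m) n,
      ((pA (k.natAbs : ℝ) (m - k.natAbs) (l - max k.natAbs m) xr : ℝ) : ℂ) * Y l k θ φ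

lemma b_pos (α : ℝ) (hα : 0 ≤ α) (l : ℕ) : 0 < b α l := by
  cases l with
  | zero =>
    simp only [b]
    have h1 : 0 < Real.Gamma (α + 1) := Real.Gamma_pos_of_pos (by linarith)
    have h2 : 0 < Real.Gamma (α + 3 / 2) := Real.Gamma_pos_of_pos (by linarith)
    have h3 := Real.pi_pos
    positivity
  | succ l =>
    simp only [b]
    have : 0 < 2 * ((l : ℝ) + 1) + 2 * α - 1 := by
      have : (0 : ℝ) ≤ l := Nat.cast_nonneg l
      linarith
    apply Real.sqrt_pos.2
    positivity

lemma b_sq (α : ℝ) (hα : 0 ≤ α) (l : ℕ) :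
    b α (l + 1) ^ 2 * ((2 * l + 2 * α + 3) * (2 * l + 2 * α + 1)) =
      (l + 1) * (l + 1 + 2 * α) := by
  have hl : (0 : ℝ) ≤ l := Nat.cast_nonneg l
  have h3 : (2 * ((l : ℝ) + 1) + 2 * α + 1) * (2 * ((l : ℝ) + 1) + 2 * α - 1) =
    (2 * l + 2 * α + 3) * (2 * l + 2 * α + 1) := by ring
  simp only [b]
  rw [h3, Real.sq_sqrt (by positivity)]
  field_simp

lemma pA_zero (α : ℝ) (m : ℕ) (x : ℝ) : pA α m 0 x = 1 / b α m := by simp [pA]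

lemma pA_rec0 (α : ℝ) (hα : 0 ≤ α) (m : ℕ) (x : ℝ) :
    x * pA α m 0 x = b α (m + 1) * pA α m 1 x := by
  have := b_pos α hα (m + 1)
  simp only [pA]
  field_simp

lemma pA_rec (α : ℝ) (hα : 0 ≤ α) (m l : ℕ) (x : ℝ) :
    x * pA α m (l + 1) x = b α (m + l + 2) * pA α m (l + 2) x + b α (m + l + 1) * pA α m l x := by
  have := b_pos α hα (m + l + 2)
  rw [pA]
  field_simp
  ring

lemma p_rec0 (α : ℝ) (hα : 0 ≤ α) (x : ℝ) : x * p α 0 x = b α 1 * p α 1 x := by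
  simpa [p] using pA_rec0 α hα 0 x

lemma p_rec (α : ℝ) (hα : 0 ≤ α) (l : ℕ) (x : ℝ) :
    x * p α (l + 1) x = b α (l + 2) * p α (l + 2) x + b α (l + 1) * p α l x := by
  simpa [p] using pA_rec α hα 0 l x

lemma p_deriv (α : ℝ) (hα : 0 ≤ α) (l : ℕ) (x : ℝ) :
    ∃ d, HasDerivAt (p α l) d x ∧ (1 - x ^ 2) * d =
      (l + 2 * α + 1) * x * p α l x - (2 * l + 2 * α + 1) * b α (l + 1) * p α (l + 1) x := by
  induction l using Nat.twoStepInduction with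
  | zero =>
    refine ⟨0, ?_, ?_⟩
    · have : p α 0 = fun _ => 1 / b α 0 := by funext y; simp [p, pA]
      rw [this]; exact hasDerivAt_const _ _
    · have := p_rec0 α hα x
      push_cast
      linear_combination (-(2 * α + 1)) * this
  | one =>
    have hb := b_pos α hα 1
    have h2 : p α 1 = fun y => y * p α 0 x / b α 1 := by
      funext y; simp [p, pA]
    refine ⟨p α 0 x / b α 1, ?_, ?_⟩
    · rw [h2]
      simpa using ((hasDerivAt_id x).mul_const (p α 0 x)).div_const (b α 1)
    · have h0 := p_rec0 α hα x
      have h1 := p_rec α hα 0 x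
      have hs := b_sq α hα 0
      norm_num at h1 hs ⊢
      have hs' : b α 1 ^ 2 * (2 * α + 3) = 1 := by
        have : (2 * α + 1) ≠ 0 := by positivity
        apply mul_right_cancel₀ this
        linear_combination hs
      have e : p α 1 x = x * p α 0 x / b α 1 := by
        field_simp; linear_combination -h0
      have e2 : b α 2 * p α 2 x = x * p α 1 x - b α 1 * p α 0 x := by linear_combination -h1
      rw [mul_assoc (2 + 2 * α + 1), e2, e]
      field_simp
      linear_combination (-(p α 0 x)) * hs'
  | more l ih1 ih2 =>
    obtain ⟨d1, hd1, h1⟩ := ih1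
    obtain ⟨d2, hd2, h2⟩ := ih2
    have hb := b_pos α hα (l + 2)
    have hf : p α (l + 2) = fun y => (y * p α (l + 1) y - b α (l + 1) * p α l y) / b α (l + 2) := by
      funext y; simp [p, pA]
    refine ⟨(1 * p α (l + 1) x + x * d2 - b α (l + 1) * d1) / b α (l + 2), ?_, ?_⟩
    · rw [hf]
      exact ((((hasDerivAt_id x).mul hd2).sub (hd1.const_mul _))).div_const _
    · have r1 := p_rec α hα l x
      have r2 := p_rec α hα (l + 1) x
      have hs1 := b_sq α hα l
      have hs2 := b_sq α hα (l + 1)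
      have hl : (0 : ℝ) ≤ l := Nat.cast_nonneg l
      push_cast at *
      have key : 1 + (2 * l + 2 * α + 1) * b α (l + 1) ^ 2 =
          (2 * l + 2 * α + 5) * b α (l + 2) ^ 2 := by
        have : (2 * l + 2 * α + 3) ≠ 0 := by positivity
        apply mul_right_cancel₀ this
        have hs2' : b α (l + 2) ^ 2 * ((2 * (l + 1) + 2 * α + 3) * (2 * (l + 1) + 2 * α + 1)) =
          (l + 1 + 1) * (l + 1 + 1 + 2 * α) := hs2
        linear_combination hs1 - hs2'
      apply mul_right_cancel₀ hb.ne'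
      rw [mul_assoc, div_mul_cancel₀ _ hb.ne']
      have r2' : x * p α (l + 2) x = b α (l + 3) * p α (l + 3) x + b α (l + 2) * p α (l + 1) x := r2
      change _ = ((l + 2 + 2 * α + 1) * x * p α (l + 2) x -
        (2 * (l + 2) + 2 * α + 1) * b α (l + 3) * p α (l + 3) x) * b α (l + 2)
      change (1 - x ^ 2) * d2 = (l + 1 + 2 * α + 1) * x * p α (l + 1) x -
        (2 * (l + 1) + 2 * α + 1) * b α (l + 2) * p α (l + 2) x at h2
      linear_combination x * h2 - b α (l + 1) * h1 + p α (l + 1) x * key -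
        (2 * (l + 2) + 2 * α + 1) * b α (l + 2) * r2' + (l+2*α+1) * x * r1

lemma p_cont (α : ℝ) (hα : 0 ≤ α) (l : ℕ) : Continuous (p α l) := by
  rw [continuous_iff_continuousAt]
  intro x
  obtain ⟨d, hd, -⟩ := p_deriv α hα l x
  exact hd.continuousAt

/-- weighted integral -/
def W (k : ℕ) (f : ℝ → ℝ) : ℝ :=
  1 / 2 * ∫ θ in (0 : ℝ)..Real.pi, Real.sin θ ^ (2 * k + 1) * f (Real.cos θ)

lemma W_add (k : ℕ) (f g : ℝ → ℝ) (hf : Continuous f) (hg : Continuous g) :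
    W k (fun x => f x + g x) = W k f + W k g := by
  unfold W
  rw [← mul_add, ← intervalIntegral.integral_add]
  · congr 2; funext θ; ring
  · apply Continuous.intervalIntegrable; fun_prop
  · apply Continuous.intervalIntegrable; fun_prop

lemma W_smul (k : ℕ) (c : ℝ) (f : ℝ → ℝ) : W k (fun x => c * f x) = c * W k f := by
  unfold W
  rw [mul_left_comm, ← intervalIntegral.integral_const_mul c]
  congr 2; funext θ; ring

lemma W_one (k : ℕ) : W k (fun _ => 1) = b k 0 ^ 2 := by
  have h3 := Real.pi_pos
  have hg : ∀ k : ℕ, 0 < Real.Gamma ((k : ℝ) + 1) ∧ 0 < Real.Gamma ((k : ℝ) + 3 / 2) := fun k =>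
    ⟨Real.Gamma_pos_of_pos (by positivity), Real.Gamma_pos_of_pos (by positivity)⟩
  have hb : ∀ k : ℕ, b k 0 ^ 2 =
      Real.sqrt Real.pi * Real.Gamma ((k : ℝ) + 1) / (2 * Real.Gamma ((k : ℝ) + 3 / 2)) := by
    intro k
    have := hg k
    simp only [b]
    rw [Real.sq_sqrt]
    have := this.1; have := (hg k).2
    positivity
  rw [hb]
  unfold W
  simp only [mul_one]
  induction k with
  | zero =>
    have : Real.Gamma (3 / 2) = Real.sqrt Real.pi / 2 := by
      have := Real.Gamma_add_one (s := 1 / 2) (by norm_num)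
      rw [Real.Gamma_one_half_eq] at this
      norm_num at this ⊢
      linarith
    simp [this]
    norm_num
    field_simp
  | succ k ih =>
    have e : 2 * (k + 1) + 1 = (2 * k + 1) + 2 := by ring
    rw [e, integral_sin_pow]
    have g1 := Real.Gamma_add_one (s := (k : ℝ) + 1) (by positivity)
    have g2 := Real.Gamma_add_one (s := (k : ℝ) + 3 / 2) (by positivity)
    have e1 : ((k + 1 : ℕ) : ℝ) + 1 = (k : ℝ) + 1 + 1 := by push_cast; ring
    have e2 : ((k + 1 : ℕ) : ℝ) + 3 / 2 = (k : ℝ) + 3 / 2 + 1 := by push_cast; ring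
    rw [e1, e2, g1, g2]
    have h1 := (hg k).1
    have h2 := (hg k).2
    simp only [Real.sin_zero, Real.sin_pi, ne_eq, Nat.add_eq_zero_iff, one_ne_zero, and_false,
      not_false_eq_true, zero_pow, zero_mul, sub_zero, zero_div, zero_add]
    rw [mul_left_comm, ih]
    push_cast
    field_simp
    ring

lemma W_p (k : ℕ) (l : ℕ) : W k (p k (l + 1)) = 0 := by
  have hk : (0 : ℝ) ≤ k := Nat.cast_nonneg k
  have main : ∀ l : ℕ, W k (fun x => (2 * k + 2) * (x * p k l x) -
      ((l + 2 * k + 1) * x * p k l x - (2 * l + 2 * k + 1) * b k (l + 1) * p k (l + 1) x)) = 0 := by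
    intro l
    have c1 := p_cont k hk l
    have c2 := p_cont k hk (l + 1)
    unfold W
    rw [intervalIntegral.integral_eq_sub_of_hasDerivAt
      (f := fun θ => Real.sin θ ^ (2 * k + 2) * p k l (Real.cos θ))]
    · simp
    · intro θ _
      obtain ⟨d, hd, h⟩ := p_deriv k hk l (Real.cos θ)
      have := ((Real.hasDerivAt_sin θ).pow (2 * k + 2)).mul
        (hd.comp θ (Real.hasDerivAt_cos θ))
      refine this.congr_deriv ?_
      beta_reduce
      rw [← h]
      have hs := Real.sin_sq θ
      simp only [Nat.add_one_sub_one, Pi.pow_apply, Function.comp]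
      push_cast
      rw [← hs]
      ring
    · apply Continuous.intervalIntegrable; fun_prop
  induction l using Nat.twoStepInduction with
  | zero =>
    have h := main 0
    have : (fun x => (2 * (k : ℝ) + 2) * (x * p k 0 x) -
      (((0 : ℕ) + 2 * k + 1) * x * p k 0 x - (2 * (0 : ℕ) + 2 * k + 1) * b k (0 + 1) * p k (0 + 1) x))
      = fun x => ((2 * k + 2) * b k 1) * p k 1 x := by
      funext x
      have := p_rec0 k hk x
      push_cast
      simp only [zero_add]
      linear_combination (1 : ℝ) * this
    rw [this, W_smul] at h
    have hb := b_pos k hk 1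
    rcases mul_eq_zero.1 h with h | h
    · exfalso; revert h; positivity
    · exact h
  | one =>
    have h := main 1
    have : (fun x => (2 * (k : ℝ) + 2) * (x * p k 1 x) -
      (((1 : ℕ) + 2 * k + 1) * x * p k 1 x - (2 * (1 : ℕ) + 2 * k + 1) * b k (1 + 1) * p k (1 + 1) x))
      = fun x => ((2 * k + 3) * b k 2) * p k 2 x := by
      funext x
      push_cast
      norm_num
      ring
    rw [this, W_smul] at h
    have hb := b_pos k hk 2
    rcases mul_eq_zero.1 h with h | h
    · exfalso; revert h; positivity
    · exact h
  | more l ih _ =>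
    have h := main (l + 2)
    have : (fun x => (2 * (k : ℝ) + 2) * (x * p k (l + 2) x) -
      (((l + 2 : ℕ) + 2 * k + 1) * x * p k (l + 2) x -
        (2 * (l + 2 : ℕ) + 2 * k + 1) * b k (l + 2 + 1) * p k (l + 2 + 1) x))
      = fun x => ((l + 2 * k + 4) * b k (l + 3)) * p k (l + 3) x +
        (-(l + 1) * b k (l + 2)) * p k (l + 1) x := by
      funext x
      have : x * p k (l + 2) x = b k (l + 3) * p k (l + 3) x + b k (l + 2) * p k (l + 1) x :=
        p_rec k hk (l + 1) x
      push_cast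
      change (2 * (k : ℝ) + 2) * (x * p k (l + 2) x) -
        ((l + 2 + 2 * k + 1) * x * p k (l + 2) x -
        (2 * (l + 2) + 2 * k + 1) * b k (l + 3) * p k (l + 3) x) = _
      linear_combination (-(l + 1 : ℝ)) * this
    have c1 := p_cont k hk (l + 3)
    have c2 := p_cont k hk (l + 1)
    rw [this, W_add _ _ _ (by fun_prop) (by fun_prop), W_smul, W_smul, ih, mul_zero, add_zero] at h
    have hb := b_pos k hk (l + 3)
    rcases mul_eq_zero.1 h with h | h
    · exfalso; revert h; positivity
    · exact h

lemma W_xp0 (k : ℕ) (f : ℝ → ℝ) :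
    W k (fun x => x * p k 0 x * f x) = b k 1 * W k (fun x => p k 1 x * f x) := by
  rw [← W_smul]; congr 1; funext x
  rw [p_rec0 k (Nat.cast_nonneg k)]; ring

lemma W_xp (k l : ℕ) (f : ℝ → ℝ) (hf : Continuous f) :
    W k (fun x => x * p k (l + 1) x * f x) = b k (l + 2) * W k (fun x => p k (l + 2) x * f x)
      + b k (l + 1) * W k (fun x => p k l x * f x) := by
  have hk : (0 : ℝ) ≤ k := Nat.cast_nonneg k
  have c1 := p_cont k hk (l + 2)
  have c2 := p_cont k hk l
  rw [← W_smul, ← W_smul, ← W_add _ _ _ (by fun_prop) (by fun_prop)]; congr 1; funext x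
  rw [p_rec k hk]; ring

lemma W_comm (k : ℕ) (f g : ℝ → ℝ) : W k (fun x => f x * g x) = W k (fun x => g x * f x) := by
  congr 1; funext x; ring

lemma W_orth (k i j : ℕ) : W k (fun x => p k i x * p k j x) = if i = j then 1 else 0 := by
  have hk : (0 : ℝ) ≤ k := Nat.cast_nonneg k
  have hb := fun l => b_pos k hk l
  have hp0 : p (k : ℝ) 0 = fun _ => 1 / b k 0 := by funext y; simp [p, pA]
  have h0 : ∀ j, W k (fun x => p k 0 x * p k j x) = if 0 = j then 1 else 0 := by
    intro j
    rw [hp0]; simp only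
    rw [W_smul]
    cases j with
    | zero =>
      rw [hp0]
      have := W_smul k (1 / b k 0) (fun _ => 1)
      simp only [mul_one] at this
      rw [this, W_one]
      have := hb 0
      simp; field_simp
    | succ j => rw [W_p]; simp
  have sym : ∀ i j, W k (fun x => x * p k i x * p k j x) = W k (fun x => x * p k j x * p k i x) := by
    intro i j; congr 1; funext x; ring
  have comm := fun i j => W_comm k (p k i) (p k j)
  induction i using Nat.twoStepInduction generalizing j with
  | zero => exact h0 j
  | one =>
    have e := sym 0 j
    rw [W_xp0] at e
    apply mul_left_cancel₀ (hb 1).ne'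
    rw [e]
    cases j with
    | zero => rw [W_xp0, comm, h0]; simp
    | succ j =>
      rw [W_xp _ _ _ (p_cont k hk 0), comm, h0, comm, h0]
      rcases j with _ | j <;> simp
  | more i ih1 ih2 =>
    have e := sym (i + 1) j
    rw [W_xp _ _ _ (p_cont k hk j), ih1] at e
    apply mul_left_cancel₀ (hb (i + 2)).ne'
    rw [eq_sub_of_add_eq e]
    cases j with
    | zero =>
      rw [W_xp0, comm, ih2]
      rcases i with _ | i <;> simp
    | succ j =>
      rw [W_xp _ _ _ (p_cont k hk (i + 1)), comm, ih2, comm, ih2]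
      by_cases h1 : i = j + 1
      · subst h1
        have : ¬ (j + 1 + 1 = j) := by omega
        simp [this]
      · by_cases h2 : i + 1 = j
        · subst h2; simp [h1]
        · have : ¬ (i + 1 = j + 2) := by omega
          have : ¬ (i + 2 = j + 1) := by omega
          simp [*]

lemma W_JE (k μ i j : ℕ) :
    W k (fun x => x * p k (μ + i) x * p k (μ + j) x) = JE k μ i j := by
  have hk : (0 : ℝ) ≤ k := Nat.cast_nonneg k
  unfold JE
  have gen : ∀ s t, W k (fun x => x * p k s x * p k t x) =
      if s + 1 = t then b k (s + 1) else if t + 1 = s then b k (t + 1) else 0 := by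
    intro s t
    cases s with
    | zero =>
      rw [W_xp0, W_orth]
      by_cases h : 1 = t
      · subst h; simp
      · simp [h]
    | succ s =>
      rw [W_xp _ _ _ (p_cont k hk t), W_orth, W_orth]
      by_cases h : s + 2 = t
      · subst h; simp
      · by_cases h2 : s = t
        · subst h2
          have : ¬ (s + 1 + 1 = s) := by omega
          simp [this]
        · have : ¬ (t = s) := fun h => h2 h.symm
          simp [*]
  rw [gen]
  simp only [add_assoc, add_right_inj]

/-- continuity on the parameter plane -/
def Nice (f : ℝ → ℝ → ℂ) : Prop := Continuous (fun q : ℝ × ℝ => f q.1 q.2)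

lemma region_compact : IsCompact region := isCompact_Icc.prod isCompact_Icc

lemma region_meas : MeasurableSet region := measurableSet_Icc.prod measurableSet_Icc

lemma inner2_sum {ι κ : Type*} (s : Finset ι) (t : Finset κ) (c : ι → ℂ) (d : κ → ℂ)
    (f : ι → ℝ → ℝ → ℂ) (g : κ → ℝ → ℝ → ℂ) (hf : ∀ i, Nice (f i)) (hg : ∀ i, Nice (g i)) :
    inner2 (fun θ φ => ∑ i ∈ s, c i * f i θ φ) (fun θ φ => ∑ j ∈ t, d j * g j θ φ) =
      ∑ i ∈ s, ∑ j ∈ t, c i * (starRingEnd ℂ) (d j) * inner2 (f i) (g j) := by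
  unfold inner2
  have : ∀ q : ℝ × ℝ, (∑ i ∈ s, c i * f i q.1 q.2) * (starRingEnd ℂ) (∑ j ∈ t, d j * g j q.1 q.2) *
      ((Real.sin q.1 : ℝ) : ℂ) = ∑ i ∈ s, ∑ j ∈ t, (c i * (starRingEnd ℂ) (d j)) *
        (f i q.1 q.2 * (starRingEnd ℂ) (g j q.1 q.2) * ((Real.sin q.1 : ℝ) : ℂ)) := by
    intro q
    rw [map_sum, Finset.sum_mul_sum, Finset.sum_mul]
    refine Finset.sum_congr rfl fun i _ => ?_
    rw [Finset.sum_mul]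
    refine Finset.sum_congr rfl fun j _ => ?_
    rw [map_mul]; ring
  have hc : ∀ i j, Continuous (fun q : ℝ × ℝ => (c i * (starRingEnd ℂ) (d j)) *
        (f i q.1 q.2 * (starRingEnd ℂ) (g j q.1 q.2) * ((Real.sin q.1 : ℝ) : ℂ))) := by
    intro i j
    have h1 : Continuous (fun q : ℝ × ℝ => f i q.1 q.2) := hf i
    have h2 : Continuous (fun q : ℝ × ℝ => g j q.1 q.2) := hg j
    have h3 : Continuous (fun q : ℝ × ℝ => (starRingEnd ℂ) (g j q.1 q.2)) :=
      Complex.continuous_conj.comp h2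
    have h4 : Continuous (fun q : ℝ × ℝ => ((Real.sin q.1 : ℝ) : ℂ)) := by fun_prop
    exact continuous_const.mul ((h1.mul h3).mul h4)
  have hi : ∀ i j, IntegrableOn (fun q : ℝ × ℝ => (c i * (starRingEnd ℂ) (d j)) *
        (f i q.1 q.2 * (starRingEnd ℂ) (g j q.1 q.2) * ((Real.sin q.1 : ℝ) : ℂ))) region :=
    fun i j => (hc i j).continuousOn.integrableOn_compact region_compact
  simp_rw [this]
  rw [integral_finsetSum _ (fun i _ => integrable_finsetSum _ fun j _ => hi i j), Finset.mul_sum]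
  refine Finset.sum_congr rfl fun i _ => ?_
  rw [integral_finsetSum _ (fun j _ => hi i j), Finset.mul_sum]
  refine Finset.sum_congr rfl fun j _ => ?_
  rw [integral_const_mul]; ring

lemma exp_int (k : ℤ) : ∫ φ in Set.Icc (0 : ℝ) (2 * Real.pi), Complex.exp (Complex.I * k * φ) =
    if k = 0 then 2 * (Real.pi : ℂ) else 0 := by
  have hp := Real.pi_pos
  rw [integral_Icc_eq_integral_Ioc, ← intervalIntegral.integral_of_le (by positivity)]
  split_ifs with h
  · subst h; simp
  · have hk : (Complex.I * k : ℂ) ≠ 0 := by simp [h]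
    rw [integral_exp_mul_complex hk]
    have : Complex.exp (Complex.I * k * ((2 * Real.pi : ℝ) : ℂ)) = 1 := by
      rw [Complex.exp_eq_one_iff]
      exact ⟨k, by push_cast; ring⟩
    rw [this]; simp

lemma inner2_sep (F G : ℝ → ℝ) (k k' : ℤ) :
    inner2 (fun θ φ => (F θ : ℂ) * Complex.exp (Complex.I * k * φ))
      (fun θ φ => (G θ : ℂ) * Complex.exp (Complex.I * k' * φ)) =
    if k = k' then ((1 / 2 * ∫ θ in (0 : ℝ)..Real.pi, F θ * G θ * Real.sin θ : ℝ) : ℂ) else 0 := by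
  have hp := Real.pi_pos
  unfold inner2 region
  have : ∀ q : ℝ × ℝ, (F q.1 : ℂ) * Complex.exp (Complex.I * k * q.2) *
      (starRingEnd ℂ) ((G q.1 : ℂ) * Complex.exp (Complex.I * k' * q.2)) *
      ((Real.sin q.1 : ℝ) : ℂ) = ((F q.1 * G q.1 * Real.sin q.1 : ℝ) : ℂ) *
        Complex.exp (Complex.I * (k - k' : ℤ) * q.2) := by
    intro q
    rw [map_mul, ← Complex.exp_conj]
    simp only [map_mul, Complex.conj_ofReal, Complex.conj_I, map_intCast]
    have : Complex.exp (Complex.I * (k - k' : ℤ) * q.2) =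
      Complex.exp (Complex.I * k * q.2) * Complex.exp (-Complex.I * k' * q.2) := by
      rw [← Complex.exp_add]; congr 1; push_cast; ring
    rw [this]; push_cast; ring
  simp_rw [this]
  rw [Measure.volume_eq_prod, setIntegral_prod_mul (fun θ : ℝ => ((F θ * G θ * Real.sin θ : ℝ) : ℂ))
    (fun φ : ℝ => Complex.exp (Complex.I * (k - k' : ℤ) * φ)), exp_int, integral_complex_ofReal,
    integral_Icc_eq_integral_Ioc, ← intervalIntegral.integral_of_le hp.le]
  by_cases h : k = k'
  · subst h
    simp
    have : (Real.pi : ℂ) ≠ 0 := by exact_mod_cast hp.ne'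
    field_simp
    norm_num
    ring
  · have : k - k' ≠ 0 := sub_ne_zero.2 h
    simp [h, this]

lemma Y_eq (l : ℕ) (k : ℤ) : Y l k = fun (θ φ : ℝ) =>
    ((Real.sin θ ^ k.natAbs * p (k.natAbs : ℝ) (l - k.natAbs) (Real.cos θ) : ℝ) : ℂ) *
    Complex.exp (Complex.I * k * φ) := by
  funext θ φ; unfold Y; push_cast; ring

lemma MY_eq (l : ℕ) (k : ℤ) : Mop (Y l k) = fun (θ φ : ℝ) =>
    ((Real.cos θ * (Real.sin θ ^ k.natAbs * p (k.natAbs : ℝ) (l - k.natAbs) (Real.cos θ)) : ℝ) : ℂ) *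
    Complex.exp (Complex.I * k * φ) := by
  funext θ φ; unfold Mop; rw [Y_eq]; push_cast; ring

lemma Y_nice (l : ℕ) (k : ℤ) : Nice (Y l k) := by
  unfold Nice
  rw [Y_eq]
  have := p_cont (k.natAbs : ℝ) (Nat.cast_nonneg _) (l - k.natAbs)
  fun_prop

lemma M_nice (f : ℝ → ℝ → ℂ) (hf : Nice f) : Nice (Mop f) := by
  unfold Nice Mop at *
  fun_prop

lemma sum_nice {ι : Type*} (s : Finset ι) (c : ι → ℂ) (f : ι → ℝ → ℝ → ℂ) (hf : ∀ i, Nice (f i)) :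
    Nice (fun θ φ => ∑ i ∈ s, c i * f i θ φ) := by
  unfold Nice at *
  fun_prop

lemma inner_YY (l l' : ℕ) (k k' : ℤ) (h : k ≠ k') : inner2 (Y l k) (Y l' k') = 0 := by
  rw [Y_eq, Y_eq, inner2_sep, if_neg h]

lemma inner_MYY (l l' : ℕ) (k k' : ℤ) (h : k ≠ k') : inner2 (Mop (Y l k)) (Y l' k') = 0 := by
  rw [MY_eq, Y_eq, inner2_sep, if_neg h]

lemma idx (m k j : ℕ) : max k m + j - k = (m - k) + j := by omega

lemma inner_YY' (m j j' : ℕ) (k : ℤ) :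
    inner2 (Y (max k.natAbs m + j) k) (Y (max k.natAbs m + j') k) = if j = j' then 1 else 0 := by
  rw [Y_eq, Y_eq, inner2_sep, if_pos rfl, idx, idx]
  have := W_orth k.natAbs (m - k.natAbs + j) (m - k.natAbs + j')
  unfold W at this
  simp only [add_right_inj] at this
  have e : (if j = j' then (1 : ℂ) else 0) = ((if j = j' then (1 : ℝ) else 0 : ℝ) : ℂ) := by
    split_ifs <;> simp
  rw [e, ← this]
  congr 3; funext θ; ring

lemma inner_MYY' (m j j' : ℕ) (k : ℤ) :
    inner2 (Mop (Y (max k.natAbs m + j) k)) (Y (max k.natAbs m + j') k) =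
      ((JE k.natAbs (m - k.natAbs) j j' : ℝ) : ℂ) := by
  rw [MY_eq, Y_eq, inner2_sep, if_pos rfl, idx, idx]
  rw [← W_JE]
  unfold W
  congr 3; funext θ; ring

lemma JE_symm (α : ℝ) (μ i j : ℕ) : JE α μ i j = JE α μ j i := by
  unfold JE
  by_cases h : i + 1 = j
  · have : ¬ (j + 1 = i) := by omega
    simp [h, this]
  · simp [h]

lemma JE_eig (α : ℝ) (hα : 0 ≤ α) (μ N : ℕ) (x : ℝ) (hx : pA α μ N x = 0) (j : ℕ) (hj : j < N) :
    ∑ j' ∈ Finset.range N, JE α μ j j' * pA α μ j' x = x * pA α μ j x := by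
  have h1 : ∑ j' ∈ Finset.range N, JE α μ j j' * pA α μ j' x =
      ∑ j' ∈ Finset.range (N + 1), JE α μ j j' * pA α μ j' x := by
    rw [Finset.sum_range_succ, hx]; simp
  rw [h1]
  cases j with
  | zero =>
    rw [Finset.sum_eq_single 1]
    · rw [pA_rec0 α hα]; simp [JE]
    · intro j' _ h
      have : ¬ (0 + 1 = j') := by omega
      simp [JE]; intro h; omega
    · intro h; exfalso; simp at h; omega
  | succ t =>
    have : ∀ j' ∈ Finset.range (N + 1), JE α μ (t + 1) j' * pA α μ j' x =
        (if j' = t + 2 then b α (μ + t + 2) * pA α μ (t + 2) x else 0) +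
        (if j' = t then b α (μ + t + 1) * pA α μ t x else 0) := by
      intro j' _
      unfold JE
      by_cases h : j' = t + 2
      · subst h; simp [add_assoc]
      · by_cases h2 : j' = t
        · subst h2
          have h3 : ¬ (j' + 1 + 1 = j') := by omega
          simp [h3]
        · have h3 : ¬ (t + 1 + 1 = j') := by omega
          simp [h, h2, h3]
    rw [Finset.sum_congr rfl this, Finset.sum_add_distrib, Finset.sum_ite_eq', Finset.sum_ite_eq',
      if_pos (by simp; omega), if_pos (by simp; omega), pA_rec α hα]

lemma pA_orth (α : ℝ) (hα : 0 ≤ α) (μ N : ℕ) (x y : ℝ) (hx : pA α μ N x = 0) (hy : pA α μ N y = 0)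
    (hxy : x ≠ y) : ∑ j ∈ Finset.range N, pA α μ j x * pA α μ j y = 0 := by
  have h : x * ∑ j ∈ Finset.range N, pA α μ j x * pA α μ j y =
      y * ∑ j ∈ Finset.range N, pA α μ j x * pA α μ j y := by
    calc _ = ∑ j ∈ Finset.range N, ∑ j' ∈ Finset.range N,
          JE α μ j j' * pA α μ j' x * pA α μ j y := by
          rw [Finset.mul_sum]
          refine Finset.sum_congr rfl fun j hj => ?_
          rw [← Finset.sum_mul, JE_eig α hα μ N x hx j (Finset.mem_range.1 hj)]; ring
      _ = ∑ j' ∈ Finset.range N, ∑ j ∈ Finset.range N,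
          JE α μ j' j * pA α μ j y * pA α μ j' x := by
          rw [Finset.sum_comm]
          refine Finset.sum_congr rfl fun j _ => Finset.sum_congr rfl fun j' _ => ?_
          rw [JE_symm]; ring
      _ = _ := by
          rw [Finset.mul_sum]
          refine Finset.sum_congr rfl fun j hj => ?_
          rw [← Finset.sum_mul, JE_eig α hα μ N y hy j (Finset.mem_range.1 hj)]; ring
  have h2 : (x - y) * ∑ j ∈ Finset.range N, pA α μ j x * pA α μ j y = 0 := by linarith
  exact (mul_eq_zero.1 h2).resolve_left (sub_ne_zero.2 hxy)

/-- coefficient vectors -/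
def vv (n m k : ℕ) (xr : ℝ) (j : ℕ) : ℝ := kap n m k xr * pA (k : ℝ) (m - k) j xr

lemma Icc_sum {A : Type*} [AddCommMonoid A] (n m k : ℕ) (hmn : m ≤ n) (hk : k ≤ n) (f : ℕ → A) :
    ∑ l ∈ Finset.Icc (max k m) n, f l = ∑ j ∈ Finset.range (Nk n m k), f (max k m + j) := by
  have : Finset.Icc (max k m) n = Finset.Ico (max k m) (n + 1) := by
    ext; simp
  rw [this, Finset.sum_Ico_eq_sum_range]
  have h : n + 1 - max k m = Nk n m k := by unfold Nk; have := max_le hk hmn; omega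
  rw [h]

lemma kap_eq (n m k : ℕ) (hmn : m ≤ n) (hk : k ≤ n) (xr : ℝ) :
    kap n m k xr ^ 2 * ∑ j ∈ Finset.range (Nk n m k), pA (k : ℝ) (m - k) j xr ^ 2 = 1 := by
  unfold kap
  rw [Icc_sum n m k hmn hk]
  simp only [Nat.add_sub_cancel_left]
  have hpos : 0 < ∑ j ∈ Finset.range (Nk n m k), pA (k : ℝ) (m - k) j xr ^ 2 := by
    apply Finset.sum_pos' (fun _ _ => sq_nonneg _)
    refine ⟨0, by simp [Nk], ?_⟩
    rw [pA_zero]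
    have := b_pos k (Nat.cast_nonneg k) (m - k)
    positivity
  rw [inv_pow, Real.sq_sqrt hpos.le, inv_mul_cancel₀ hpos.ne']

lemma vv_orth (n m k : ℕ) (hmn : m ≤ n) (hk : k ≤ n) (x y : ℝ)
    (hx : pA (k : ℝ) (m - k) (Nk n m k) x = 0) (hy : pA (k : ℝ) (m - k) (Nk n m k) y = 0) :
    ∑ j ∈ Finset.range (Nk n m k), vv n m k x j * vv n m k y j = if x = y then 1 else 0 := by
  have e : ∑ j ∈ Finset.range (Nk n m k), vv n m k x j * vv n m k y j =
      kap n m k x * kap n m k y *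
      ∑ j ∈ Finset.range (Nk n m k), pA (k : ℝ) (m - k) j x * pA (k : ℝ) (m - k) j y := by
    rw [Finset.mul_sum]
    refine Finset.sum_congr rfl fun j _ => ?_
    unfold vv; ring
  rw [e]
  split_ifs with h
  · subst h
    rw [← kap_eq n m k hmn hk x]
    simp only [sq]
  · rw [pA_orth _ (Nat.cast_nonneg k) _ _ _ _ hx hy h, mul_zero]

lemma psi_eq (n m : ℕ) (k : ℤ) (hmn : m ≤ n) (hk : k.natAbs ≤ n) (xr : ℝ) :
    psiFun n m k xr = fun θ φ => ∑ j ∈ Finset.range (Nk n m k.natAbs),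
      ((vv n m k.natAbs xr j : ℝ) : ℂ) * Y (max k.natAbs m + j) k θ φ := by
  funext θ φ
  unfold psiFun
  rw [Icc_sum n m _ hmn hk, Finset.mul_sum]
  refine Finset.sum_congr rfl fun j _ => ?_
  rw [Nat.add_sub_cancel_left]
  unfold vv; push_cast; ring

lemma Mpsi_eq (n m : ℕ) (k : ℤ) (hmn : m ≤ n) (hk : k.natAbs ≤ n) (xr : ℝ) :
    Mop (psiFun n m k xr) = fun θ φ => ∑ j ∈ Finset.range (Nk n m k.natAbs),
      ((vv n m k.natAbs xr j : ℝ) : ℂ) * Mop (Y (max k.natAbs m + j) k) θ φ := by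
  rw [psi_eq n m k hmn hk]
  funext θ φ
  unfold Mop
  rw [Finset.mul_sum]
  refine Finset.sum_congr rfl fun j _ => ?_
  ring

lemma psi_nice (n m : ℕ) (k : ℤ) (xr : ℝ) : Nice (psiFun n m k xr) := by
  have := fun l => Y_nice l k
  unfold Nice psiFun at *
  fun_prop

lemma psi_ne (n m : ℕ) (k k' : ℤ) (hmn : m ≤ n) (hk : k.natAbs ≤ n) (hk' : k'.natAbs ≤ n)
    (h : k ≠ k') (x y : ℝ) : inner2 (psiFun n m k x) (psiFun n m k' y) = 0 ∧
      inner2 (Mop (psiFun n m k x)) (psiFun n m k' y) = 0 := by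
  rw [Mpsi_eq n m k hmn hk, psi_eq n m k hmn hk, psi_eq n m k' hmn hk']
  constructor
  · rw [inner2_sum _ _ _ _ _ _ (fun _ => Y_nice _ _) (fun _ => Y_nice _ _)]
    refine Finset.sum_eq_zero fun i _ => Finset.sum_eq_zero fun j _ => ?_
    rw [inner_YY _ _ _ _ h, mul_zero]
  · rw [inner2_sum _ _ _ _ _ _ (fun _ => M_nice _ (Y_nice _ _)) (fun _ => Y_nice _ _)]
    refine Finset.sum_eq_zero fun i _ => Finset.sum_eq_zero fun j _ => ?_
    rw [inner_MYY _ _ _ _ h, mul_zero]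

lemma psi_same (n m : ℕ) (k : ℤ) (hmn : m ≤ n) (hk : k.natAbs ≤ n) (x y : ℝ)
    (hx : pA (k.natAbs : ℝ) (m - k.natAbs) (Nk n m k.natAbs) x = 0)
    (hy : pA (k.natAbs : ℝ) (m - k.natAbs) (Nk n m k.natAbs) y = 0) :
    inner2 (psiFun n m k x) (psiFun n m k y) = (if x = y then 1 else 0) ∧
      inner2 (Mop (psiFun n m k x)) (psiFun n m k y) = (if x = y then (x : ℂ) else 0) := by
  have ho := vv_orth n m k.natAbs hmn hk x y hx hy
  rw [Mpsi_eq n m k hmn hk, psi_eq n m k hmn hk, psi_eq n m k hmn hk]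
  constructor
  · rw [inner2_sum _ _ _ _ _ _ (fun _ => Y_nice _ _) (fun _ => Y_nice _ _)]
    have e : (if x = y then (1 : ℂ) else 0) = ((if x = y then (1 : ℝ) else 0 : ℝ) : ℂ) := by
      split_ifs <;> simp
    rw [e, ← ho, Complex.ofReal_sum]
    refine Finset.sum_congr rfl fun i hi => ?_
    simp_rw [inner_YY', Complex.conj_ofReal]
    rw [Finset.sum_eq_single i]
    · simp
    · intro j _ h; simp [h.symm]
    · intro h; exact absurd hi h
  · rw [inner2_sum _ _ _ _ _ _ (fun _ => M_nice _ (Y_nice _ _)) (fun _ => Y_nice _ _)]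
    have e : (if x = y then (x : ℂ) else 0) = ((y * if x = y then (1 : ℝ) else 0 : ℝ) : ℂ) := by
      split_ifs with h <;> simp [h]
    rw [e, ← ho, Finset.mul_sum, Complex.ofReal_sum]
    refine Finset.sum_congr rfl fun i hi => ?_
    simp_rw [inner_MYY', Complex.conj_ofReal]
    have := JE_eig (k.natAbs : ℝ) (Nat.cast_nonneg _) _ _ y hy i (Finset.mem_range.1 hi)
    have h2 : y * (vv n m k.natAbs x i * vv n m k.natAbs y i) =
      vv n m k.natAbs x i * kap n m k.natAbs y * (y * pA (k.natAbs : ℝ) (m - k.natAbs) i y) := by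
      unfold vv; ring
    rw [h2, ← this, Finset.mul_sum, Complex.ofReal_sum]
    refine Finset.sum_congr rfl fun j _ => ?_
    unfold vv; push_cast; ring

lemma eps_eq (f : ℝ → ℝ → ℂ) (hf : Nice f) : (eps f : ℂ) = inner2 (Mop f) f := by
  unfold eps inner2 Mop
  push_cast
  rw [← integral_complex_ofReal]
  congr 2; funext q
  have := Complex.mul_conj' (f q.1 q.2)
  push_cast
  rw [← this]; ring

lemma eps_le (f : ℝ → ℝ → ℂ) (hf : Nice f) : eps f ≤ (inner2 f f).re := by
  have h1 : (((1 / (4 * Real.pi)) * ∫ q in region, ‖f q.1 q.2‖ ^ 2 * Real.sin q.1 : ℝ) : ℂ) =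
      inner2 f f := by
    unfold inner2
    push_cast
    rw [← integral_complex_ofReal]
    congr 2; funext q
    have := Complex.mul_conj' (f q.1 q.2)
    push_cast
    rw [← this]
  rw [← h1, Complex.ofReal_re]
  unfold eps
  have hp := Real.pi_pos
  unfold Nice at hf
  apply mul_le_mul_of_nonneg_left _ (by positivity)
  apply setIntegral_mono_on
  · exact (by fun_prop : Continuous (fun q : ℝ × ℝ => Real.cos q.1 * ‖f q.1 q.2‖ ^ 2 *
      Real.sin q.1)).continuousOn.integrableOn_compact region_compact
  · exact (by fun_prop : Continuous (fun q : ℝ × ℝ => ‖f q.1 q.2‖ ^ 2 *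
      Real.sin q.1)).continuousOn.integrableOn_compact region_compact
  · exact region_meas
  · intro q hq
    have hs : 0 ≤ Real.sin q.1 := Real.sin_nonneg_of_mem_Icc hq.1
    have := Real.cos_le_one q.1
    apply mul_le_mul_of_nonneg_right _ hs
    nlinarith [sq_nonneg ‖f q.1 q.2‖]

lemma abstract_bound {ι : Type*} [DecidableEq ι] (S : Finset ι) (ψ : ι → ℝ → ℝ → ℂ) (x : ι → ℝ)
    (hψ : ∀ s, Nice (ψ s))
    (ho : ∀ s ∈ S, ∀ t ∈ S, inner2 (ψ s) (ψ t) = if s = t then 1 else 0)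
    (hM : ∀ s ∈ S, ∀ t ∈ S, inner2 (Mop (ψ s)) (ψ t) = if s = t then (x s : ℂ) else 0)
    (a : ℝ) (ha : 0 < a) (Q : ℝ → ℝ → ℂ) (d : ι → ℂ)
    (hQ : Q = fun θ φ => ∑ s ∈ S, d s * ψ s θ φ) (hQn : norm2 Q = 1) :
    norm2 (fun θ φ => Q θ φ - ∑ s ∈ S.filter (fun s => 1 - a < x s),
      inner2 Q (ψ s) * ψ s θ φ) ^ 2 ≤ (1 - eps Q) / a := by
  have hn : ∀ T : Finset ι, T ⊆ S → inner2 (fun θ φ => ∑ s ∈ T, d s * ψ s θ φ)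
      (fun θ φ => ∑ s ∈ T, d s * ψ s θ φ) = ((∑ s ∈ T, ‖d s‖ ^ 2 : ℝ) : ℂ) := by
    intro T hT
    rw [inner2_sum _ _ _ _ _ _ hψ hψ, Complex.ofReal_sum]
    refine Finset.sum_congr rfl fun s hs => ?_
    rw [Finset.sum_eq_single s]
    · rw [ho s (hT hs) s (hT hs), if_pos rfl, mul_one, Complex.mul_conj']; push_cast; rfl
    · intro t ht h
      rw [ho s (hT hs) t (hT ht), if_neg h.symm, mul_zero]
    · intro h; exact absurd hs h
  have hd : ∀ t ∈ S, inner2 Q (ψ t) = d t := by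
    intro t ht
    have e : ψ t = fun θ φ => ∑ u ∈ ({t} : Finset ι), (fun _ => (1 : ℂ)) u * ψ u θ φ := by
      funext θ φ; simp
    rw [e, hQ, inner2_sum _ _ _ _ _ _ hψ hψ, Finset.sum_eq_single t]
    · rw [Finset.sum_singleton, ho t ht t ht]; simp
    · intro s hs h
      rw [Finset.sum_singleton, ho s hs t ht]; simp [h]
    · intro h; exact absurd ht h
  have h1 : ∑ s ∈ S, ‖d s‖ ^ 2 = 1 := by
    have h := hn S (Finset.Subset.refl _)
    unfold norm2 at hQn
    rw [hQ, h, Complex.ofReal_re, Real.sqrt_eq_one] at hQn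
    exact hQn
  have hQnice : Nice Q := by rw [hQ]; exact sum_nice _ _ _ hψ
  have h2 : eps Q = ∑ s ∈ S, x s * ‖d s‖ ^ 2 := by
    have h := eps_eq Q hQnice
    have e : Mop Q = fun θ φ => ∑ s ∈ S, d s * Mop (ψ s) θ φ := by
      funext θ φ; rw [hQ]; unfold Mop; rw [Finset.mul_sum]
      refine Finset.sum_congr rfl fun j _ => ?_
      ring
    rw [e] at h
    rw [hQ, inner2_sum _ _ _ _ _ _ (fun s => M_nice _ (hψ s)) hψ] at h
    rw [hQ]
    apply Complex.ofReal_injective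
    rw [h, Complex.ofReal_sum]
    refine Finset.sum_congr rfl fun s hs => ?_
    rw [Finset.sum_eq_single s]
    · rw [hM s hs s hs, if_pos rfl, Complex.mul_conj']; push_cast; ring
    · intro t ht h
      rw [hM s hs t ht, if_neg h.symm, mul_zero]
    · intro h; exact absurd hs h
  have h3 : ∀ s ∈ S, x s ≤ 1 := by
    intro s hs
    have h := eps_le _ (hψ s)
    have h' := eps_eq _ (hψ s)
    rw [hM s hs s hs, if_pos rfl] at h'
    rw [ho s hs s hs, if_pos rfl, Complex.ofReal_injective h'] at h
    simpa using h
  have e : (fun θ φ => Q θ φ - ∑ s ∈ S.filter (fun s => 1 - a < x s),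
      inner2 Q (ψ s) * ψ s θ φ) = fun θ φ => ∑ s ∈ S.filter (fun s => ¬ 1 - a < x s),
      d s * ψ s θ φ := by
    funext θ φ
    have : ∑ s ∈ S.filter (fun s => 1 - a < x s), inner2 Q (ψ s) * ψ s θ φ =
        ∑ s ∈ S.filter (fun s => 1 - a < x s), d s * ψ s θ φ :=
      Finset.sum_congr rfl fun s hs => by rw [hd s (Finset.mem_filter.1 hs).1]
    rw [this, sub_eq_iff_eq_add', Finset.sum_filter_add_sum_filter_not, hQ]
  rw [e]
  unfold norm2
  rw [hn _ (Finset.filter_subset _ _), Complex.ofReal_re, Real.sq_sqrt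
    (Finset.sum_nonneg fun _ _ => sq_nonneg _), le_div_iff₀ ha, h2, Finset.sum_mul]
  have h5 : 1 - ∑ s ∈ S, x s * ‖d s‖ ^ 2 = ∑ s ∈ S, (‖d s‖ ^ 2 - x s * ‖d s‖ ^ 2) := by
    rw [Finset.sum_sub_distrib, h1]
  rw [h5]
  calc ∑ s ∈ S.filter (fun s => ¬ 1 - a < x s), ‖d s‖ ^ 2 * a ≤ ∑ s ∈ S.filter (fun s => ¬ 1 - a < x s), (‖d s‖ ^ 2 - x s * ‖d s‖ ^ 2) := by
        refine Finset.sum_le_sum fun s hs => ?_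
        have := (Finset.mem_filter.1 hs).2
        nlinarith [sq_nonneg ‖d s‖]
    _ ≤ _ := by
        refine Finset.sum_le_sum_of_subset_of_nonneg (Finset.filter_subset _ _) fun s hs _ => ?_
        have := h3 s hs
        nlinarith [sq_nonneg ‖d s‖]

lemma Y_span (n m : ℕ) (k : ℤ) (hmn : m ≤ n) (hk : k.natAbs ≤ n) (x : ℕ → ℝ)
    (hroot : ∀ i < Nk n m k.natAbs,
      pA (k.natAbs : ℝ) (m - k.natAbs) (Nk n m k.natAbs) (x i) = 0)
    (hinj : ∀ i < Nk n m k.natAbs, ∀ j < Nk n m k.natAbs, x i = x j → i = j)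
    (j : ℕ) (hj : j < Nk n m k.natAbs) (θ φ : ℝ) :
    Y (max k.natAbs m + j) k θ φ = ∑ i ∈ Finset.range (Nk n m k.natAbs),
      ((vv n m k.natAbs (x i) j : ℝ) : ℂ) * psiFun n m k (x i) θ φ := by
  set N := Nk n m k.natAbs with hN
  let V : Matrix (Fin N) (Fin N) ℝ := Matrix.of fun i j => vv n m k.natAbs (x i) j
  have h1 : V * V.transpose = 1 := by
    ext i i'
    have := vv_orth n m k.natAbs hmn hk (x i) (x i') (hroot i i.2) (hroot i' i'.2)
    rw [Matrix.mul_apply, Matrix.one_apply]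
    simp only [Matrix.transpose_apply, V, Matrix.of_apply]
    rw [Fin.sum_univ_eq_sum_range (fun j => vv n m k.natAbs (x i) j * vv n m k.natAbs (x i') j) N,
      this]
    by_cases h : i = i'
    · subst h; simp
    · have : ¬ x i = x i' := fun h' => h (Fin.ext (hinj i i.2 i' i'.2 h'))
      simp [h, this]
  have h2 : V.transpose * V = 1 := mul_eq_one_comm.1 h1
  have h3 : ∀ j' < N, ∑ i ∈ Finset.range N, vv n m k.natAbs (x i) j * vv n m k.natAbs (x i) j' =
      if j = j' then 1 else 0 := by
    intro j' hj'
    have := congrFun (congrFun h2 ⟨j, hj⟩) ⟨j', hj'⟩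
    rw [Matrix.mul_apply, Matrix.one_apply] at this
    simp only [Matrix.transpose_apply, V, Matrix.of_apply, Fin.mk.injEq] at this
    rw [Fin.sum_univ_eq_sum_range
      (fun i => vv n m k.natAbs (x i) j * vv n m k.natAbs (x i) j') N] at this
    exact this
  simp_rw [psi_eq n m k hmn hk, Finset.mul_sum]
  rw [Finset.sum_comm, Finset.sum_eq_single j]
  · have := h3 j hj
    rw [if_pos rfl] at this
    simp_rw [← mul_assoc]
    rw [← Finset.sum_mul]
    have h4 : ∑ i ∈ Finset.range N, ((vv n m k.natAbs (x i) j : ℝ) : ℂ) *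
        ((vv n m k.natAbs (x i) j : ℝ) : ℂ) = 1 := by exact_mod_cast this
    rw [h4, one_mul]
  · intro j' hj' h
    have := h3 j' (Finset.mem_range.1 hj')
    rw [if_neg h.symm] at this
    simp_rw [← mul_assoc]
    rw [← Finset.sum_mul]
    have h4 : ∑ i ∈ Finset.range N, ((vv n m k.natAbs (x i) j : ℝ) : ℂ) *
        ((vv n m k.natAbs (x i) j' : ℝ) : ℂ) = 0 := by exact_mod_cast this
    rw [h4, zero_mul]
  · intro h; exact absurd (Finset.mem_range.2 hj) h

/-- index set -/
def SS (n m : ℕ) : Finset (Σ _ : ℤ, ℕ) :=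
  (Finset.Icc (-(n : ℤ)) (n : ℤ)).sigma (fun k => Finset.range (Nk n m k.natAbs))

lemma Q_rep (n m : ℕ) (hmn : m ≤ n) (x : ℕ → ℕ → ℝ)
    (hroot : ∀ k : ℕ, k ≤ n → ∀ i < Nk n m k, pA (k : ℝ) (m - k) (Nk n m k) (x k i) = 0)
    (hinj : ∀ k : ℕ, k ≤ n → ∀ i < Nk n m k, ∀ j < Nk n m k, x k i = x k j → i = j)
    (Q : ℝ → ℝ → ℂ) (hQ : Q ∈ Pi_nm n m) :
    ∃ d : (Σ _ : ℤ, ℕ) → ℂ, Q = fun θ φ => ∑ s ∈ SS n m, d s *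
      psiFun n m s.1 (x s.1.natAbs s.2) θ φ := by
  unfold Pi_nm at hQ
  induction hQ using Submodule.span_induction with
  | mem f hf =>
    obtain ⟨l, k, hml, hln, hkl, rfl⟩ := hf
    have hkn := hkl.trans hln
    obtain ⟨j, rfl⟩ := Nat.exists_eq_add_of_le (max_le hkl hml)
    have hj : j < Nk n m k.natAbs := by unfold Nk; omega
    refine ⟨fun s => if s.1 = k then ((vv n m k.natAbs (x k.natAbs s.2) j : ℝ) : ℂ) else 0, ?_⟩
    funext θ φ
    unfold SS
    rw [Finset.sum_sigma, Finset.sum_eq_single k]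
    · simp only [if_true]
      exact Y_span n m k hmn hkn (x k.natAbs) (hroot _ hkn) (hinj _ hkn) j hj θ φ
    · intro k' _ h; simp [h]
    · intro h; exfalso; apply h; simp; omega
  | zero => exact ⟨fun _ => 0, by funext θ φ; simp⟩
  | add f g _ _ hf hg =>
    obtain ⟨d1, rfl⟩ := hf
    obtain ⟨d2, rfl⟩ := hg
    refine ⟨fun s => d1 s + d2 s, ?_⟩
    funext θ φ
    simp only [Pi.add_apply, add_mul, Finset.sum_add_distrib]
  | smul c f _ hf =>
    obtain ⟨d1, rfl⟩ := hf
    refine ⟨fun s => c * d1 s, ?_⟩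
    funext θ φ
    simp only [Pi.smul_apply, smul_eq_mul, Finset.mul_sum, mul_assoc]

/-- for `Q ∈ Π_n^m` with `‖Q‖ = 1` and `a > 0`,
`‖Q − Σ_{k} Σ_{i : x_{|k|,i} ∈ (1−a,1]} ⟨Q,ψ_{k,i}⟩ ψ_{k,i}‖² ≤ (1−ε(Q))/a`. -/
theorem stmt11 (n m : ℕ) (hmn : m ≤ n) (a : ℝ) (ha : 0 < a) (x : ℕ → ℕ → ℝ)
    (hroot : ∀ k : ℕ, k ≤ n → ∀ i < Nk n m k, pA (k : ℝ) (m - k) (Nk n m k) (x k i) = 0)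
    (hinj : ∀ k : ℕ, k ≤ n → ∀ i < Nk n m k, ∀ j < Nk n m k, x k i = x k j → i = j)
    (Q : ℝ → ℝ → ℂ) (hQ : Q ∈ Pi_nm n m) (hQn : norm2 Q = 1) :
    norm2 (fun θ φ => Q θ φ -
        ∑ k ∈ Finset.Icc (-(n : ℤ)) (n : ℤ),
          ∑ i ∈ (Finset.range (Nk n m k.natAbs)).filter (fun i => 1 - a < x k.natAbs i),
            inner2 Q (psiFun n m k (x k.natAbs i)) * psiFun n m k (x k.natAbs i) θ φ) ^ 2 ≤
      (1 - eps Q) / a := by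
  obtain ⟨d, hd⟩ := Q_rep n m hmn x hroot hinj Q hQ
  have key := abstract_bound (SS n m) (fun s => psiFun n m s.1 (x s.1.natAbs s.2))
    (fun s => x s.1.natAbs s.2) (fun s => psi_nice _ _ _ _) ?_ ?_ a ha Q d hd hQn
  · convert key using 5 with θ φ
    unfold SS
    have : ((Finset.Icc (-(n : ℤ)) (n : ℤ)).sigma (fun k => Finset.range (Nk n m k.natAbs))).filter
        (fun s => 1 - a < x s.1.natAbs s.2) = (Finset.Icc (-(n : ℤ)) (n : ℤ)).sigma
        (fun k => (Finset.range (Nk n m k.natAbs)).filter (fun i => 1 - a < x k.natAbs i)) := by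
      ext s
      simp only [Finset.mem_filter, Finset.mem_sigma, and_assoc]
    rw [this, Finset.sum_sigma]
  all_goals
    rintro ⟨k, i⟩ hs ⟨k', i'⟩ ht
    simp only [SS, Finset.mem_sigma, Finset.mem_Icc, Finset.mem_range] at hs ht
    have hk : k.natAbs ≤ n := by omega
    have hk' : k'.natAbs ≤ n := by omega
    by_cases h : k = k'
    · subst h
      have hh := psi_same n m k hmn hk (x k.natAbs i) (x k.natAbs i') (hroot _ hk i hs.2)
        (hroot _ hk i' ht.2)
      have hiff : x k.natAbs i = x k.natAbs i' ↔ i = i' :=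
        ⟨hinj _ hk i hs.2 i' ht.2, fun h => by rw [h]⟩
      simp only [hh.1, hh.2, hiff, Sigma.mk.injEq, heq_eq_eq, true_and]
    · have hh := psi_ne n m k k' hmn hk hk' h (x k.natAbs i) (x k'.natAbs i')
      simp only [hh.1, hh.2, Sigma.mk.injEq, h, false_and, if_false]
end SFT
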